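/- The number of monotone Boolean functions of 7 variables that are fixed points of the transposition of Fin 7 swapping indices 0 and 1 equals 2208001624. -/

import Mathlib

/-- The order of Boolean functions on their truth tables, read as binary numbers. -/
def codeLE (a b : ℕ) : Bool := Nat.beq (Nat.land a b) a

/-- The truth tables of the monotone Boolean functions of `n` variables. -/
def codes : ℕ → List ℕ
  | 0 => [0, 1]
  | n + 1 => (codes n).flatMap fun g =>
      ((codes n).filter fun f => codeLE f g).map fun f => 2 ^ 2 ^ n * g + f

/-- `List.foldr`, defined directly by the recursor so that the kernel evaluates it quickly. -/
noncomputable def fold {α : Type} (f : α → ℕ → ℕ) (z : ℕ) (l : List α) : ℕ :=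
  List.rec (motive := fun _ => ℕ) z (fun a _ acc => f a acc) l

/-- `if b then x else y`, defined directly by the recursor. -/
noncomputable def select (b : Bool) (x y : ℕ) : ℕ :=
  Bool.rec (motive := fun _ => ℕ) y x b

/-- The number with base `65536` digits `F b`, for `b` in the list, least significant first. -/
noncomputable def packRow (F : ℕ → ℕ) (L : List ℕ) : ℕ :=
  fold (fun b acc => Nat.add (F b) (Nat.mul 65536 acc)) 0 L

/-- A matrix with rows and columns indexed by `L`, each row packed into one number. -/
noncomputable def packRows (L : List ℕ) (F : ℕ → ℕ → ℕ) : List (ℕ × ℕ) :=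
  L.map fun a => (a, packRow (F a) L)

/-- The product of the indicator matrix of the relation `p` with a packed matrix. -/
noncomputable def mulRows (L : List ℕ) (p : ℕ → ℕ → Bool) (R : List (ℕ × ℕ)) : List (ℕ × ℕ) :=
  L.map fun a => (a, fold (fun r acc => select (p a r.1) (Nat.add r.2 acc) acc) 0 R)

/-- The sum of the products of those digits of `r` and `s` whose index `b` is above `a`. -/
noncomputable def dotRow (a : ℕ) (L : List ℕ) : ℕ → ℕ → ℕ :=
  List.rec (motive := fun _ => ℕ → ℕ → ℕ) (fun _ _ => 0)
    (fun b _ ih r s => Nat.add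
      (select (codeLE a b) (Nat.mul (Nat.mod r 65536) (Nat.mod s 65536)) 0)
      (ih (Nat.div r 65536) (Nat.div s 65536))) L

/-- The sum of the products of corresponding entries of two packed matrices, over the pairs of
comparable indices. -/
noncomputable def dotRows (L : List ℕ) (R S : List (ℕ × ℕ)) : ℕ :=
  fold (fun x acc => Nat.add (dotRow x.1.1 L x.1.2 x.2.2) acc) 0 (R.zip S)

/-- The number of order-preserving maps from the product of chains of lengths `2` and `3` to the
truth tables in `L`. -/
noncomputable def gridCount (L : List ℕ) : ℕ :=
  dotRows L
    (mulRows L (fun a b => codeLE b a)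
      (mulRows L codeLE (packRows L fun a b => select (codeLE a b) 1 0)))
    (mulRows L codeLE
      (mulRows L codeLE (packRows L fun a b => select (codeLE b a) 1 0)))

theorem gridCount_codes_four : gridCount (codes 4) = 2208001624 := by decide +kernel

theorem nodup_codes_four : (codes 4).Nodup := by decide +kernel

theorem length_codes_four : (codes 4).length = 168 := by decide +kernel

theorem fold_eq_foldr {α : Type} (f : α → ℕ → ℕ) (z : ℕ) (l : List α) :
    fold f z l = l.foldr f z := by
  induction l with
  | nil => rfl
  | cons a l ih => rw [List.foldr_cons, ← ih]; rfl

theorem fold_add {α : Type} (F : α → ℕ) (l : List α) :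
    fold (fun a acc => F a + acc) 0 l = (l.map F).sum := by
  rw [fold_eq_foldr, List.sum, List.foldr_map]

theorem select_eq_ite (b : Bool) (x y : ℕ) : select b x y = if b then x else y := by
  cases b <;> rfl

theorem packRow_cons (F : ℕ → ℕ) (b : ℕ) (L : List ℕ) :
    packRow F (b :: L) = F b + 65536 * packRow F L := rfl

theorem packRow_zero (L : List ℕ) : packRow (fun _ => 0) L = 0 := by
  induction L with
  | nil => rfl
  | cons b L ih => rw [packRow_cons, ih]

theorem packRow_add (F G : ℕ → ℕ) (L : List ℕ) :
    packRow (fun b => F b + G b) L = packRow F L + packRow G L := by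
  induction L with
  | nil => rfl
  | cons b L ih => simp only [packRow_cons, ih]; ring

/-- The product of the indicator matrix of `p` with the matrix `F`. -/
def relMul (L : List ℕ) (p : ℕ → ℕ → Bool) (F : ℕ → ℕ → ℕ) (a b : ℕ) : ℕ :=
  (L.map fun k => if p a k then F k b else 0).sum

theorem mulRows_packRows (L : List ℕ) (p : ℕ → ℕ → Bool) (F : ℕ → ℕ → ℕ) :
    mulRows L p (packRows L F) = packRows L (relMul L p F) := by
  have key (M : List ℕ) (a : ℕ) :
      ((M.map fun k => (k, packRow (F k) L)).foldr
        (fun r acc => select (p a r.1) (Nat.add r.2 acc) acc) 0) =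
      packRow (relMul M p F a) L := by
    induction M with
    | nil => exact (packRow_zero L).symm
    | cons k M ih =>
      have h : relMul (k :: M) p F a =
          fun b => (if p a k then F k b else 0) + relMul M p F a b := by
        funext b; simp [relMul]
      rw [List.map_cons, List.foldr_cons, ih, h, packRow_add, select_eq_ite]
      split_ifs with hp
      · rfl
      · simp [packRow_zero]
  simp only [mulRows, packRows, fold_eq_foldr, key]

theorem relMul_le (L : List ℕ) (p : ℕ → ℕ → Bool) (F : ℕ → ℕ → ℕ) (N : ℕ)
    (hF : ∀ a b, F a b ≤ N) (a b : ℕ) : relMul L p F a b ≤ L.length * N := by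
  have := List.sum_le_card_nsmul (L.map fun k => if p a k then F k b else 0) N (by
    intro x hx
    obtain ⟨k, -, rfl⟩ := List.mem_map.1 hx
    split_ifs
    · exact hF k b
    · exact N.zero_le)
  simpa [relMul] using this

theorem dotRow_packRow (a : ℕ) (L : List ℕ) (F G : ℕ → ℕ) (hF : ∀ b, F b < 65536)
    (hG : ∀ b, G b < 65536) : dotRow a L (packRow F L) (packRow G L) =
      (L.map fun b => if codeLE a b then F b * G b else 0).sum := by
  induction L with
  | nil => rfl
  | cons b L ih =>
    have digit (x y : ℕ) (hx : x < 65536) :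
        (x + 65536 * y) % 65536 = x ∧ (x + 65536 * y) / 65536 = y := by omega
    have step (r s : ℕ) : dotRow a (b :: L) r s =
        select (codeLE a b) ((r % 65536) * (s % 65536)) 0 +
          dotRow a L (r / 65536) (s / 65536) := rfl
    rw [step, packRow_cons, packRow_cons, (digit _ _ (hF b)).1, (digit _ _ (hF b)).2,
      (digit _ _ (hG b)).1, (digit _ _ (hG b)).2, ih, select_eq_ite, List.map_cons, List.sum_cons]

theorem dotRows_packRows (L : List ℕ) (F G : ℕ → ℕ → ℕ) (hF : ∀ a b, F a b < 65536)
    (hG : ∀ a b, G a b < 65536) : dotRows L (packRows L F) (packRows L G) =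
      (L.map fun a => (L.map fun b => if codeLE a b then F a b * G a b else 0).sum).sum := by
  refine (fold_add (fun x : (ℕ × ℕ) × ℕ × ℕ => dotRow x.1.1 L x.1.2 x.2.2) _).trans ?_
  simp only [packRows, List.zip_map', List.map_map, Function.comp_def,
    dotRow_packRow _ L _ _ (hF _) (hG _)]

theorem gridCount_eq_sum (L : List ℕ) (hL : L.length < 256) :
    gridCount L = (L.map fun a => (L.map fun b => if codeLE a b then
      relMul L (fun a b => codeLE b a)
        (relMul L codeLE fun a b => if codeLE a b then 1 else 0) a b *
      relMul L codeLE
        (relMul L codeLE fun a b => if codeLE b a then 1 else 0) a b else 0).sum).sum := by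
  have bound (p q r : ℕ → ℕ → Bool) (a b : ℕ) :
      relMul L p (relMul L q fun a b => if r a b then 1 else 0) a b < 65536 := by
    have := relMul_le L p _ _ (relMul_le L q (fun a b => if r a b then 1 else 0) 1
      fun a b => by split_ifs <;> simp) a b
    nlinarith
  simp only [gridCount, mulRows_packRows, select_eq_ite]
  exact dotRows_packRows L _ _ (bound _ _ _) (bound _ codeLE fun a b => codeLE b a)

theorem codeLE_iff (a b : ℕ) :
    codeLE a b ↔ ∀ i, a.testBit i = true → b.testBit i = true := by
  have h : codeLE a b ↔ a &&& b = a := Iff.of_eq Nat.beq_eq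
  rw [h]
  constructor
  · intro h i hi
    rw [← h, Nat.testBit_and, Bool.and_eq_true] at hi
    exact hi.2
  · intro h
    refine Nat.eq_of_testBit_eq fun i => ?_
    rw [Nat.testBit_and]
    have := h i
    revert this
    cases a.testBit i <;> simp

theorem codeLE_two_pow_mul_add (k a b c d : ℕ) (ha : a < 2 ^ k) (hc : c < 2 ^ k) :
    codeLE (2 ^ k * b + a) (2 ^ k * d + c) ↔ codeLE a c ∧ codeLE b d := by
  simp only [codeLE_iff, Nat.testBit_two_pow_mul_add _ ha, Nat.testBit_two_pow_mul_add _ hc]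
  constructor
  · refine fun h => ⟨fun i hi => ?_, fun i hi => ?_⟩
    · have hik : i < k := by
        by_contra! hk
        rw [Nat.testBit_lt_two_pow (ha.trans_le (Nat.pow_le_pow_right two_pos hk))] at hi
        exact Bool.false_ne_true hi
      simpa [hik, hi] using h i
    · simpa [hi] using h (i + k)
  · rintro ⟨h₁, h₂⟩ i
    split_ifs
    · exact h₁ i
    · exact h₂ _

/-- The truth table of a Boolean function, read as a binary number. -/
def encode : (n : ℕ) → ((Fin n → Bool) → Bool) → ℕ
  | 0, f => (f ![]).toNat
  | n + 1, f => 2 ^ 2 ^ n * encode n (fun x => f (Matrix.vecCons true x)) +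
      encode n (fun x => f (Matrix.vecCons false x))

theorem encode_lt (n : ℕ) (f : (Fin n → Bool) → Bool) : encode n f < 2 ^ 2 ^ n := by
  induction n with
  | zero => exact Bool.toNat_lt _
  | succ n ih =>
    have h₀ := ih fun x => f (Matrix.vecCons false x)
    have h₁ := ih fun x => f (Matrix.vecCons true x)
    rw [encode, pow_succ 2 n, pow_mul]
    nlinarith

theorem vecCons_le_vecCons {n : ℕ} {p q : Bool} {x y : Fin n → Bool} (h : p ≤ q) (hxy : x ≤ y) :
    Matrix.vecCons p x ≤ Matrix.vecCons q y :=
  Fin.cons_le_cons.2 ⟨h, hxy⟩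

theorem codeLE_encode (n : ℕ) (f g : (Fin n → Bool) → Bool) :
    codeLE (encode n f) (encode n g) ↔ f ≤ g := by
  induction n with
  | zero =>
    have : f ≤ g ↔ f ![] ≤ g ![] :=
      ⟨fun h => h _, fun h x => by rwa [Subsingleton.elim x ![]]⟩
    rw [this, encode, encode]
    cases f ![] <;> cases g ![] <;> decide
  | succ n ih =>
    rw [encode, encode, codeLE_two_pow_mul_add _ _ _ _ _ (encode_lt n _) (encode_lt n _), ih, ih]
    refine ⟨fun h x => ?_, fun h => ⟨fun x => h _, fun x => h _⟩⟩
    rw [← Matrix.cons_head_tail x]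
    cases Matrix.vecHead x
    · exact h.1 _
    · exact h.2 _

theorem encode_injective (n : ℕ) : Function.Injective (encode n) := fun f g h =>
  le_antisymm ((codeLE_encode n f g).1 (h ▸ (codeLE_encode n f f).2 le_rfl))
    ((codeLE_encode n g f).1 (h ▸ (codeLE_encode n f f).2 le_rfl))

theorem mem_codes_iff (n c : ℕ) :
    c ∈ codes n ↔ ∃ f : (Fin n → Bool) → Bool, Monotone f ∧ encode n f = c := by
  induction n generalizing c with
  | zero =>
    simp only [codes, List.mem_cons, List.not_mem_nil, or_false]
    constructor
    · rintro (rfl | rfl)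
      · exact ⟨fun _ => false, monotone_const, rfl⟩
      · exact ⟨fun _ => true, monotone_const, rfl⟩
    · rintro ⟨f, -, rfl⟩
      rw [encode]
      cases f ![] <;> simp
  | succ n ih =>
    simp only [codes, List.mem_flatMap, List.mem_map, List.mem_filter, ih]
    constructor
    · rintro ⟨_, ⟨g, hg, rfl⟩, _, ⟨⟨f, hf, rfl⟩, hfg⟩, rfl⟩
      rw [codeLE_encode] at hfg
      refine ⟨fun x => cond (Matrix.vecHead x) (g (Matrix.vecTail x)) (f (Matrix.vecTail x)),
        fun x y hxy => ?_, by simp [encode]⟩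
      have ht : Matrix.vecTail x ≤ Matrix.vecTail y := fun i => hxy _
      have hh : Matrix.vecHead x ≤ Matrix.vecHead y := hxy _
      dsimp only
      revert hh
      cases Matrix.vecHead x <;> cases Matrix.vecHead y <;> intro hh
      · exact hf ht
      · exact (hf ht).trans (hfg _)
      · exact absurd hh (by decide)
      · exact hg ht
    · rintro ⟨f, hf, rfl⟩
      exact ⟨_, ⟨_, fun x y h => hf (vecCons_le_vecCons le_rfl h), rfl⟩, _,
        ⟨⟨_, fun x y h => hf (vecCons_le_vecCons le_rfl h), rfl⟩,
          (codeLE_encode n _ _).2 fun x => hf (vecCons_le_vecCons (by decide) le_rfl)⟩, rfl⟩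

theorem sum_encode (n : ℕ) (hn : (codes n).Nodup) [Fintype ((Fin n → Bool) →o Bool)] (H : ℕ → ℕ) :
    ∑ f : (Fin n → Bool) →o Bool, H (encode n f) = ((codes n).map H).sum := by
  rw [← List.sum_toFinset H hn]
  refine Finset.sum_bij (fun f _ => encode n f) (fun f _ => ?_) (fun f _ g _ h => ?_)
    (fun c hc => ?_) (fun _ _ => rfl)
  · rw [List.mem_toFinset, mem_codes_iff]
    exact ⟨f, f.monotone, rfl⟩
  · exact DFunLike.coe_injective (encode_injective n h)
  · rw [List.mem_toFinset, mem_codes_iff] at hc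
    obtain ⟨f, hf, rfl⟩ := hc
    exact ⟨⟨f, hf⟩, Finset.mem_univ _, rfl⟩

/-- The tuple `t = ((b₀, b₁), (a₀, a₁), (c₀, c₁))` satisfies `aᵢ ≤ bᵢ ≤ cᵢ`, `a₀ ≤ a₁`, `b₀ ≤ b₁`
and `c₀ ≤ c₁`: it is an order-preserving map from the product of chains of lengths `2` and `3`. -/
def IsGrid {P : Type*} [LE P] (t : (P × P) × (P × P) × (P × P)) : Prop :=
  t.1.1 ≤ t.1.2 ∧
    (t.2.1.1 ≤ t.1.1 ∧ t.2.1.1 ≤ t.2.1.2 ∧ t.2.1.2 ≤ t.1.2) ∧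
    (t.1.1 ≤ t.2.2.1 ∧ t.2.2.1 ≤ t.2.2.2 ∧ t.1.2 ≤ t.2.2.2)

theorem card_isGrid {P : Type*} [LE P] [DecidableLE P] [Fintype P] :
    Nat.card {t : (P × P) × (P × P) × (P × P) // IsGrid t} =
      ∑ a : P, ∑ b : P, if a ≤ b then
        (∑ k : P, if k ≤ a then ∑ m : P, if k ≤ m then if m ≤ b then 1 else 0 else 0 else 0) *
        (∑ k : P, if a ≤ k then ∑ m : P, if k ≤ m then if b ≤ m then 1 else 0 else 0 else 0)
      else 0 := by
  classical
  have pairs (p q : P → Prop) [DecidablePred p] [DecidablePred q] :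
      (∑ k : P, if p k then ∑ m : P, if k ≤ m then if q m then 1 else 0 else 0 else 0) =
        ∑ x : P × P, if p x.1 ∧ x.1 ≤ x.2 ∧ q x.2 then 1 else 0 := by
    rw [Fintype.sum_prod_type]
    refine Finset.sum_congr rfl fun k _ => ?_
    split_ifs with hk <;> simp only [hk, true_and, false_and, if_false, ite_and,
      Finset.sum_const_zero]
  rw [Nat.card_eq_fintype_card, Fintype.card_subtype, Finset.card_filter, Fintype.sum_prod_type,
    Fintype.sum_prod_type]
  refine Finset.sum_congr rfl fun a _ => Finset.sum_congr rfl fun b _ => ?_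
  have hl := pairs (· ≤ a) (· ≤ b)
  have hr := pairs (a ≤ ·) (b ≤ ·)
  rw [Fintype.sum_prod_type]
  split_ifs with hab
  · refine Eq.trans ?_ (congrArg₂ (· * ·) hl hr).symm
    simp only [Finset.sum_mul_sum, IsGrid, hab, true_and, mul_ite, mul_one, mul_zero, ← ite_and,
      and_assoc, and_comm, and_left_comm]
  · simp only [IsGrid, hab, false_and, if_false, Finset.sum_const_zero]

/-- The function of the last `n` variables obtained by fixing the first three. -/
def slice {n : ℕ} {f : (Fin (n + 3) → Bool) → Bool} (hf : Monotone f) (p q r : Bool) :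
    (Fin n → Bool) →o Bool where
  toFun z := f (Matrix.vecCons p (Matrix.vecCons q (Matrix.vecCons r z)))
  monotone' _ _ h := hf (vecCons_le_vecCons le_rfl (vecCons_le_vecCons le_rfl
    (vecCons_le_vecCons le_rfl h)))

theorem slice_le_slice {n : ℕ} {f : (Fin (n + 3) → Bool) → Bool} (hf : Monotone f)
    {p q r p' q' r' : Bool} (hp : p ≤ p') (hq : q ≤ q') (hr : r ≤ r') :
    slice hf p q r ≤ slice hf p' q' r' := fun _ =>
  hf (vecCons_le_vecCons hp (vecCons_le_vecCons hq (vecCons_le_vecCons hr le_rfl)))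

/-- The entry of a grid whose column is the number of `true` values among `p` and `q`, and whose
row is `r`. -/
def entry {P : Type*} (t : (P × P) × (P × P) × (P × P)) : Bool → Bool → Bool → P
  | false, false, false => t.2.1.1
  | false, false, true => t.2.1.2
  | true, true, false => t.2.2.1
  | true, true, true => t.2.2.2
  | true, false, false => t.1.1
  | true, false, true => t.1.2
  | false, true, false => t.1.1
  | false, true, true => t.1.2

theorem IsGrid.entry_le_entry {P : Type*} [Preorder P] {t : (P × P) × (P × P) × (P × P)}
    (ht : IsGrid t) {p q r p' q' r' : Bool} (hp : p ≤ p') (hq : q ≤ q') (hr : r ≤ r') :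
    entry t p q r ≤ entry t p' q' r' := by
  obtain ⟨hb, ⟨hab₀, ha, hab₁⟩, hbc₀, hc, hbc₁⟩ := ht
  have row {p q p' q' : Bool} (hp : p ≤ p') (hq : q ≤ q') (r : Bool) :
      entry t p q r ≤ entry t p' q' r := by
    cases p <;> cases q <;> cases p' <;> cases q' <;> cases r <;>
      first
      | exact absurd hp (by decide)
      | exact absurd hq (by decide)
      | exact le_rfl
      | exact hab₀
      | exact hab₁
      | exact hbc₀
      | exact hbc₁
      | exact hab₀.trans hbc₀
      | exact hab₁.trans hbc₁
  refine (row hp hq r).trans ?_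
  cases p' <;> cases q' <;> cases r <;> cases r' <;>
    first
    | exact absurd hr (by decide)
    | exact le_rfl
    | exact ha
    | exact hb
    | exact hc

/-- The function with prescribed slices that is symmetric in its first two variables. -/
def glue {n : ℕ} (t : (((Fin n → Bool) →o Bool) × ((Fin n → Bool) →o Bool)) ×
    (((Fin n → Bool) →o Bool) × ((Fin n → Bool) →o Bool)) ×
    (((Fin n → Bool) →o Bool) × ((Fin n → Bool) →o Bool))) (x : Fin (n + 3) → Bool) : Bool :=
  entry t (x 0) (x 1) (x 2) fun i => x i.succ.succ.succ

theorem comp_swap {n : ℕ} (x : Fin (n + 3) → Bool) :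
    x ∘ (Equiv.swap 0 1 : Equiv.Perm (Fin (n + 3))) =
      Matrix.vecCons (x 1) (Matrix.vecCons (x 0) (Matrix.vecCons (x 2)
        fun i => x i.succ.succ.succ)) := by
  funext i
  refine Fin.cases ?_ (Fin.cases ?_ fun i => ?_) i
  · exact congrArg x (Equiv.swap_apply_left 0 1)
  · exact congrArg x (Equiv.swap_apply_right 0 1)
  · refine (congrArg x (Equiv.swap_apply_of_ne_of_ne (Fin.succ_ne_zero _) ?_)).trans ?_
    · exact fun h => Fin.succ_ne_zero i (Fin.succ_injective _ h)
    · exact Fin.cases rfl (fun i => rfl) i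

/-- A monotone function that is symmetric in its first two variables amounts to its slices. -/
def fixedEquiv (n : ℕ) :
    {f : (Fin (n + 3) → Bool) → Bool // Monotone f ∧
      ∀ x, f (x ∘ (Equiv.swap 0 1 : Equiv.Perm (Fin (n + 3)))) = f x} ≃
    {t : (((Fin n → Bool) →o Bool) × ((Fin n → Bool) →o Bool)) ×
      (((Fin n → Bool) →o Bool) × ((Fin n → Bool) →o Bool)) ×
      (((Fin n → Bool) →o Bool) × ((Fin n → Bool) →o Bool)) // IsGrid t} where
  toFun f := ⟨((slice f.2.1 false true false, slice f.2.1 false true true),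
      (slice f.2.1 false false false, slice f.2.1 false false true),
      (slice f.2.1 true true false, slice f.2.1 true true true)), by
    refine ⟨?_, ⟨?_, ?_, ?_⟩, ?_, ?_, ?_⟩ <;>
      exact slice_le_slice f.2.1 (by decide) (by decide) (by decide)⟩
  invFun t := ⟨glue t.1, fun x y hxy =>
      ((entry t.1 _ _ _).monotone fun i => hxy i.succ.succ.succ).trans
        (t.2.entry_le_entry (hxy 0) (hxy 1) (hxy 2) _), fun x => by
    rw [comp_swap]
    change entry t.1 (x 1) (x 0) (x 2) _ = entry t.1 (x 0) (x 1) (x 2) _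
    cases x 0 <;> cases x 1 <;> cases x 2 <;> rfl⟩
  left_inv f := by
    obtain ⟨f, hf, hs⟩ := f
    refine Subtype.ext (funext fun x => ?_)
    have hx : x = Matrix.vecCons (x 0) (Matrix.vecCons (x 1) (Matrix.vecCons (x 2)
        fun i => x i.succ.succ.succ)) :=
      funext (Fin.cases rfl (Fin.cases rfl (Fin.cases rfl fun i => rfl)))
    have hswap := hs x
    rw [comp_swap] at hswap
    rw [hx] at hswap ⊢
    change (entry _ (x 0) (x 1) (x 2) : (Fin n → Bool) →o Bool) (fun i => x i.succ.succ.succ) = _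
    change f (Matrix.vecCons (x 1) (Matrix.vecCons (x 0) (Matrix.vecCons (x 2)
      fun i => x i.succ.succ.succ))) = _ at hswap
    generalize x 0 = p, x 1 = q, x 2 = r at hswap ⊢
    cases p <;> cases q <;> cases r <;>
      first
      | rfl
      | exact hswap
  right_inv t := rfl

theorem card_fixed_eq_gridCount (n : ℕ) (hn : (codes n).Nodup) (hl : (codes n).length < 256) :
    Nat.card {f : (Fin (n + 3) → Bool) → Bool // Monotone f ∧
      ∀ x, f (x ∘ (Equiv.swap 0 1 : Equiv.Perm (Fin (n + 3)))) = f x} = gridCount (codes n) := by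
  classical
  have : Finite ((Fin n → Bool) →o Bool) := Finite.of_injective _ DFunLike.coe_injective
  have : Fintype ((Fin n → Bool) →o Bool) := Fintype.ofFinite _
  have hle (f g : (Fin n → Bool) →o Bool) : f ≤ g ↔ codeLE (encode n f) (encode n g) :=
    (codeLE_encode n f g).symm
  rw [Nat.card_congr (fixedEquiv n), card_isGrid, gridCount_eq_sum _ hl]
  simp only [relMul, hle, ← sum_encode n hn]

/-- The number of monotone Boolean functions of 7 variables fixed by the
permutation (0 1) equals 2208001624. -/
theorem card_fixed_mbf :
    Nat.card {f : (Fin 7 → Bool) → Bool //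
      Monotone f ∧ ∀ x : Fin 7 → Bool, f (x ∘ (Equiv.swap 0 1 : Equiv.Perm (Fin 7))) = f x} = 2208001624 := by
  rw [← gridCount_codes_four]
  exact card_fixed_eq_gridCount 4 nodup_codes_four (by rw [length_codes_four]; norm_num)
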